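/- Let Ω be a bounded open Lipschitz set in ℝⁿ. Then ∫_{∂Ω} |x|² dσ ≥ R² |∂B_R| ( 1 + ((n+1)(2^{1/n}−1)/(4n)) (|Ω Δ B_R|/|B_R|)² ), where B_R is the ball centered at the origin with |B_R| = |Ω|, |∂B_R| is its boundary area, and Ω Δ B_R denotes the symmetric difference of Ω and B_R. -/

import Mathlib

open MeasureTheory Metric Set
open scoped ENNReal NNReal RealInnerProductSpace

noncomputable section

/-- The `(n-1)`-dimensional Hausdorff (surface) measure on `ℝⁿ`. -/
def surfMeasure (n : ℕ) : Measure (EuclideanSpace ℝ (Fin n)) :=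
  Measure.hausdorffMeasure ((n : ℝ) - 1)

/-- `Ω ⊆ ℝⁿ` is a Lipschitz set: near every boundary point, `Ω` is the open
region lying on one side of the graph of a Lipschitz function. -/
def HasLipschitzBoundary {n : ℕ} (Ω : Set (EuclideanSpace ℝ (Fin n))) : Prop :=
  ∀ p ∈ frontier Ω, ∃ r > (0:ℝ), ∃ e : EuclideanSpace ℝ (Fin n), ‖e‖ = 1 ∧
    ∃ f : EuclideanSpace ℝ (Fin n) → ℝ, (∃ K : ℝ≥0, LipschitzWith K f) ∧
      ∀ y ∈ ball p r, (y ∈ Ω ↔ f (y - ⟪y, e⟫ • e) < ⟪y, e⟫)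

theorem two_add_mul_sq_le_rpow_add_rpow {q t : ℝ} (hq0 : 0 ≤ q) (hq1 : q ≤ 1)
    (ht0 : 0 ≤ t) (ht1 : t ≤ 1) :
    2 + (1 + q) * ((2 : ℝ) ^ q - 1) * t ^ 2 ≤ (1 + t) ^ (1 + q) + (1 - t) ^ (1 + q) := by
  set a : ℝ := (2 : ℝ) ^ q - 1 with ha
  have haq : a ≤ q := by
    have := rpow_one_add_le_one_add_mul_self (s := 1) (by norm_num) hq0 hq1
    norm_num at this
    linarith
  have hderiv : ∀ s : ℝ, HasDerivAt
      (fun s : ℝ => (1 + s) ^ (1 + q) + (1 - s) ^ (1 + q) - (2 + (1 + q) * a * s ^ 2))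
      ((1 + q) * ((1 + s) ^ q - (1 - s) ^ q - 2 * a * s)) s := by
    intro s
    have h1 := ((hasDerivAt_id s).const_add 1).rpow_const (p := 1 + q) (Or.inr (by linarith))
    have h2 := ((hasDerivAt_id s).const_sub 1).rpow_const (p := 1 + q) (Or.inr (by linarith))
    have h3 := (((hasDerivAt_id s).pow 2).const_mul ((1 + q) * a)).const_add 2
    refine ((h1.add h2).sub h3).congr_deriv ?_
    simp only [id, add_sub_cancel_left]
    push_cast
    ring
  have hmono : MonotoneOn
      (fun s : ℝ => (1 + s) ^ (1 + q) + (1 - s) ^ (1 + q) - (2 + (1 + q) * a * s ^ 2))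
      (Icc 0 1) := by
    refine monotoneOn_of_deriv_nonneg (convex_Icc 0 1)
      (fun s _ => (hderiv s).continuousAt.continuousWithinAt)
      (fun s _ => (hderiv s).differentiableAt.differentiableWithinAt) fun s hs => ?_
    rw [interior_Icc] at hs
    rw [(hderiv s).deriv]
    have hup : 1 + a * s ≤ (1 + s) ^ q := by
      have := (Real.concaveOn_rpow hq0 hq1).2 (mem_Ici.2 zero_le_one)
        (mem_Ici.2 zero_le_two) (sub_nonneg.2 hs.2.le) hs.1.le (by ring)
      simp only [smul_eq_mul, Real.one_rpow] at this
      rw [show (1 - s) * 1 + s * 2 = 1 + s by ring] at this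
      rw [ha]
      linarith
    have hdown : (1 - s) ^ q ≤ 1 - q * s := by
      have := rpow_one_add_le_one_add_mul_self (s := -s) (by linarith [hs.2]) hq0 hq1
      rw [← sub_eq_add_neg] at this
      linarith
    have : a * s ≤ q * s := mul_le_mul_of_nonneg_right haq hs.1.le
    exact mul_nonneg (by linarith) (by linarith)
  have := hmono (left_mem_Icc.2 zero_le_one) ⟨ht0, ht1⟩ ht0
  norm_num at this
  linarith

theorem measure_ball_ne_zero_of_uniform {X : Type*} [MetricSpace X] [SecondCountableTopology X]
    [MeasurableSpace X] {μ : Measure X} (hμ : ∀ x y r, μ (ball x r) = μ (ball y r))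
    (h0 : μ ≠ 0) (x : X) {r : ℝ} (hr : 0 < r) : μ (ball x r) ≠ 0 := by
  intro h
  refine h0 (Measure.measure_univ_eq_zero.1 (measure_null_of_locally_null _ fun y _ => ?_))
  exact ⟨ball y r, mem_nhdsWithin_of_mem_nhds (ball_mem_nhds y hr), by rw [hμ y x, h]⟩

section

variable {X : Type*} [MetricSpace X] [SecondCountableTopology X] [MeasurableSpace X]
  [BorelSpace X] {μ ν : Measure X} [IsFiniteMeasure μ] [IsFiniteMeasure ν]

theorem setLIntegral_measure_ball_comm (K : Set X) (r : ℝ) :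
    ∫⁻ x in K, μ (ball x r) ∂ν = ∫⁻ y, ν (K ∩ ball y r) ∂μ := by
  have hm : MeasurableSet {p : X × X | dist p.1 p.2 < r} :=
    measurableSet_lt measurable_dist measurable_const
  have h1 := Measure.prod_apply (μ := ν.restrict K) (ν := μ) hm
  have h2 := Measure.prod_apply_symm (μ := ν.restrict K) (ν := μ) hm
  calc ∫⁻ x in K, μ (ball x r) ∂ν
      = ∫⁻ x in K, μ (Prod.mk x ⁻¹' {p : X × X | dist p.1 p.2 < r}) ∂ν := by
        refine lintegral_congr fun x => congrArg μ ?_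
        ext z
        simp [dist_comm x z]
    _ = ∫⁻ y, ν.restrict K ((fun x => (x, y)) ⁻¹' {p : X × X | dist p.1 p.2 < r}) ∂μ := by
        rw [← h1, h2]
    _ = ∫⁻ y, ν (K ∩ ball y r) ∂μ := by
        refine lintegral_congr fun y => ?_
        rw [inter_comm, ← Measure.restrict_apply measurableSet_ball]
        rfl

theorem measure_isCompact_mul_le_of_isOpen
    (hμ : ∀ x y r, μ (ball x r) = μ (ball y r)) (hν : ∀ x y r, ν (ball x r) = ν (ball y r))
    {K U : Set X} (hK : IsCompact K) (hU : IsOpen U) (hKU : K ⊆ U) :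
    ν K * μ univ ≤ ν univ * μ U := by
  rcases isEmpty_or_nonempty X with hX | ⟨⟨o⟩⟩
  · simp [Set.eq_empty_of_isEmpty K]
  rcases eq_or_ne μ 0 with h0 | h0
  · simp [h0]
  obtain ⟨r, hr, hrU⟩ := hK.exists_thickening_subset_open hU hKU
  have hball : ∀ x, μ (ball x r) = μ (ball o r) := fun x => hμ x o r
  have hball' : ∀ x, ν (ball x r) = ν (ball o r) := fun x => hν x o r
  have huniv := setLIntegral_measure_ball_comm (μ := μ) (ν := ν) univ r
  have hKK := setLIntegral_measure_ball_comm (μ := μ) (ν := ν) K r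
  simp only [hball, hball', univ_inter, lintegral_const, Measure.restrict_univ,
    Measure.restrict_apply MeasurableSet.univ] at huniv hKK
  have hle : ∫⁻ y, ν (K ∩ ball y r) ∂μ ≤ ν (ball o r) * μ U := by
    rw [← setLIntegral_const, ← lintegral_indicator hU.measurableSet]
    refine lintegral_mono fun y => ?_
    by_cases hy : y ∈ U
    · rw [indicator_of_mem hy, ← hball' y]
      exact measure_mono inter_subset_right
    · have : K ∩ ball y r = ∅ := by
        refine eq_empty_of_forall_notMem fun z hz => hy (hrU ?_)
        exact mem_thickening_iff.2 ⟨z, hz.1, by simpa [dist_comm] using hz.2⟩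
      simp [this]
  refine (ENNReal.mul_le_mul_iff_right (measure_ball_ne_zero_of_uniform hμ h0 o hr)
    (measure_ne_top μ (ball o r))).1 ?_
  calc μ (ball o r) * (ν K * μ univ) = (∫⁻ y, ν (K ∩ ball y r) ∂μ) * μ univ := by
        rw [← hKK]; ring
    _ ≤ ν (ball o r) * μ U * μ univ := by gcongr
    _ = (ν (ball o r) * μ univ) * μ U := by ring
    _ = μ (ball o r) * (ν univ * μ U) := by rw [← huniv]; ring

theorem smul_le_smul_of_measure_ball_eq [CompactSpace X]
    (hμ : ∀ x y r, μ (ball x r) = μ (ball y r)) (hν : ∀ x y r, ν (ball x r) = ν (ball y r)) :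
    μ univ • ν ≤ ν univ • μ := by
  have hcompact : ∀ K : Set X, IsCompact K → ν K * μ univ ≤ ν univ * μ K := by
    intro K hK
    rcases eq_or_ne (ν univ) 0 with h0 | h0
    · simp [measure_mono_null (subset_univ K) h0]
    simp only [K.measure_eq_iInf_isOpen μ, ENNReal.mul_iInf_of_ne h0 (measure_ne_top ν _)]
    exact le_iInf fun U => le_iInf fun hKU => le_iInf fun hU =>
      measure_isCompact_mul_le_of_isOpen hμ hν hK hU hKU
  refine Measure.le_intro fun A hA _ => ?_
  simp only [Measure.smul_apply, smul_eq_mul]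
  rw [hA.measure_eq_iSup_isCompact_of_ne_top (measure_ne_top ν A), mul_comm]
  simp only [ENNReal.iSup_mul]
  refine iSup_le fun K => iSup_le fun hKA => iSup_le fun hK => (hcompact K hK).trans ?_
  gcongr

end

section

variable {E : Type*} [NormedAddCommGroup E]

/-- The largest distance from the origin at which the ray in direction `θ` meets `Ω`. -/
def radialSup [NormedSpace ℝ E] (Ω : Set E) (θ : E) : ℝ≥0∞ :=
  ⨆ r : Ioi (0 : ℝ), {η : E | (r : ℝ) • η ∈ Ω}.indicator (fun _ => ENNReal.ofReal r) θ

section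

variable [NormedSpace ℝ E] {Ω : Set E} {θ : E}

theorem measurable_radialSup [MeasurableSpace E] [BorelSpace E] (hΩ : IsOpen Ω) :
    Measurable (radialSup Ω) := by
  refine LowerSemicontinuous.measurable (lowerSemicontinuous_iSup fun r => ?_)
  exact (hΩ.preimage (continuous_const_smul (r : ℝ))).lowerSemicontinuous_indicator zero_le

theorem ofReal_le_radialSup {r : ℝ} (hr : 0 < r) (h : r • θ ∈ Ω) :
    ENNReal.ofReal r ≤ radialSup Ω θ := by
  refine le_trans ?_ (le_iSup _ (⟨r, hr⟩ : Ioi (0 : ℝ)))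
  rw [indicator_of_mem (by exact h)]

theorem exists_lt_of_lt_radialSup {a : ℝ≥0∞} (h : a < radialSup Ω θ) :
    ∃ r : ℝ, 0 < r ∧ r • θ ∈ Ω ∧ a < ENNReal.ofReal r := by
  obtain ⟨r, hr⟩ := lt_iSup_iff.1 h
  by_cases hm : (r : ℝ) • θ ∈ Ω
  · rw [indicator_of_mem (by exact hm)] at hr
    exact ⟨r, r.2, hm, hr⟩
  · rw [indicator_of_notMem (by exact hm)] at hr
    exact absurd hr not_lt_zero

theorem exists_gt_of_smul_mem (hΩ : IsOpen Ω) {r : ℝ} (h : r • θ ∈ Ω) :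
    ∃ s > r, s • θ ∈ Ω := by
  have hc : Continuous fun s : ℝ => s • θ := by fun_prop
  exact (hc.continuousAt.eventually_mem (hΩ.mem_nhds h)).exists_gt

theorem ofReal_lt_radialSup (hΩ : IsOpen Ω) {r : ℝ} (hr : 0 < r) (h : r • θ ∈ Ω) :
    ENNReal.ofReal r < radialSup Ω θ := by
  obtain ⟨s, hs, hsΩ⟩ := exists_gt_of_smul_mem hΩ h
  exact ((ENNReal.ofReal_lt_ofReal_iff (hr.trans hs)).2 hs).trans_le
    (ofReal_le_radialSup (hr.trans hs) hsΩ)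

theorem radialSup_lt_top (hΩ : Bornology.IsBounded Ω) (hθ : ‖θ‖ = 1) : radialSup Ω θ < ⊤ := by
  obtain ⟨M, hM⟩ := hΩ.exists_norm_le
  refine lt_of_le_of_lt (not_lt.1 fun h => ?_) (ENNReal.ofReal_lt_top (r := M))
  obtain ⟨r, hr, hrΩ, hlt⟩ := exists_lt_of_lt_radialSup h
  have := hM _ hrΩ
  rw [norm_smul, hθ, mul_one, Real.norm_of_nonneg hr.le] at this
  exact absurd hlt (not_lt.2 (ENNReal.ofReal_le_ofReal this))

theorem smul_mem_frontier_of_radialSup_eq (hΩ : IsOpen Ω) (hθ : ‖θ‖ = 1) {P : ℝ} (hP : 0 < P)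
    (h : radialSup Ω θ = ENNReal.ofReal P) : P • θ ∈ frontier Ω := by
  rw [hΩ.frontier_eq]
  refine ⟨Metric.mem_closure_iff.2 fun ε hε => ?_, fun hmem => ?_⟩
  · obtain ⟨r, hr, hrΩ, hlt⟩ := exists_lt_of_lt_radialSup
      (show ENNReal.ofReal (P - ε) < radialSup Ω θ by
        rw [h]; exact (ENNReal.ofReal_lt_ofReal_iff hP).2 (by linarith))
    have hle : r ≤ P := by
      have := ofReal_le_radialSup hr hrΩ
      rwa [h, ENNReal.ofReal_le_ofReal_iff hP.le] at this
    have hlt' := (ENNReal.ofReal_lt_ofReal_iff hr).1 hlt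
    refine ⟨r • θ, hrΩ, ?_⟩
    rw [dist_eq_norm, ← sub_smul, norm_smul, hθ, mul_one, Real.norm_of_nonneg (by linarith)]
    linarith
  · exact absurd (ofReal_lt_radialSup hΩ hP hmem) (by rw [h]; exact lt_irrefl _)

end

theorem lipschitzOnWith_normalize [InnerProductSpace ℝ E] {s : ℝ≥0} (hs : 0 < s) :
    LipschitzOnWith s⁻¹ (fun x : E => ‖x‖⁻¹ • x) {x | (s : ℝ) ≤ ‖x‖} := by
  refine LipschitzOnWith.of_dist_le_mul fun x hx y hy => ?_
  have hs' : (0 : ℝ) < s := hs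
  have hx' : (s : ℝ) ≤ ‖x‖ := hx
  have hy' : (s : ℝ) ≤ ‖y‖ := hy
  have hx0 : 0 < ‖x‖ := hs'.trans_le hx'
  have hy0 : 0 < ‖y‖ := hs'.trans_le hy'
  rw [dist_eq_norm, dist_eq_norm, NNReal.coe_inv, ← div_eq_inv_mul, le_div_iff₀ hs']
  refine le_of_sq_le_sq ?_ (norm_nonneg _)
  have h1 : ‖x‖ * ‖y‖ * ‖‖x‖⁻¹ • x - ‖y‖⁻¹ • y‖ ^ 2 = 2 * (‖x‖ * ‖y‖) - 2 * ⟪x, y⟫ := by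
    rw [norm_sub_sq_real, norm_smul, norm_smul, inner_smul_left, inner_smul_right]
    simp only [norm_inv, norm_norm, conj_trivial]
    field_simp
    ring
  have h2 : ‖x - y‖ ^ 2 = ‖x‖ ^ 2 - 2 * ⟪x, y⟫ + ‖y‖ ^ 2 := norm_sub_sq_real x y
  have h3 : (s : ℝ) * s ≤ ‖x‖ * ‖y‖ := mul_le_mul hx' hy' hs'.le hx0.le
  have h4 := mul_le_mul_of_nonneg_right h3 (sq_nonneg ‖‖x‖⁻¹ • x - ‖y‖⁻¹ • y‖)
  nlinarith [sq_nonneg (‖x‖ - ‖y‖)]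

variable [MeasurableSpace E] [BorelSpace E]

open Module in
theorem finrank_add_one_mul_setLIntegral_enorm_le [NormedSpace ℝ E] [FiniteDimensional ℝ E]
    [Nontrivial E] (μ : Measure E) [μ.IsAddHaarMeasure] {Ω : Set E} (hΩ : IsOpen Ω) :
    ENNReal.ofReal (finrank ℝ E + 1) * ∫⁻ x in Ω, ‖x‖ₑ ∂μ ≤
      ∫⁻ θ, radialSup Ω θ ^ (finrank ℝ E + 1) ∂μ.toSphere := by
  set d := finrank ℝ E with hd
  have hdpos : 0 < d := finrank_pos
  set F : E → ℝ≥0∞ := Ω.indicator fun x => ‖x‖ₑ with hF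
  have hFm : Measurable F := measurable_enorm.indicator hΩ.measurableSet
  have hmp := (μ.measurePreserving_homeomorphUnitSphereProd).symm
    (homeomorphUnitSphereProd E).toMeasurableEquiv
  have hdens : ∀ s : Set (Ioi (0 : ℝ)), MeasurableSet s →
      ∫⁻ r in s, ENNReal.ofReal r ∂(Measure.volumeIoiPow (d - 1)) = Measure.volumeIoiPow d s := by
    intro s hs
    have : Measure.volumeIoiPow d =
        (Measure.volumeIoiPow (d - 1)).withDensity fun r => ENNReal.ofReal r := by
      rw [Measure.volumeIoiPow, Measure.volumeIoiPow, ← withDensity_mul _ (by fun_prop) (by fun_prop)]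
      congr 1
      funext r
      rw [Pi.mul_apply, ← ENNReal.ofReal_mul (pow_nonneg (le_of_lt r.2) _), ← pow_succ,
        Nat.sub_add_cancel hdpos]
    rw [this, withDensity_apply _ hs]
  have hinner : ∀ θ : sphere (0 : E) 1, ENNReal.ofReal (d + 1) *
      ∫⁻ r : Ioi (0 : ℝ), F ((r : ℝ) • (θ : E)) ∂(Measure.volumeIoiPow (d - 1)) ≤
        radialSup Ω θ ^ (d + 1) := by
    intro θ
    have hθ : ‖(θ : E)‖ = 1 := norm_eq_of_mem_sphere θ
    have hopen : IsOpen {r : Ioi (0 : ℝ) | (r : ℝ) • (θ : E) ∈ Ω} :=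
      hΩ.preimage (by fun_prop)
    have heq : ∫⁻ r : Ioi (0 : ℝ), F ((r : ℝ) • (θ : E)) ∂(Measure.volumeIoiPow (d - 1)) =
        Measure.volumeIoiPow d {r : Ioi (0 : ℝ) | (r : ℝ) • (θ : E) ∈ Ω} := by
      rw [← hdens _ hopen.measurableSet, ← lintegral_indicator hopen.measurableSet]
      refine lintegral_congr fun r => ?_
      by_cases hr : (r : ℝ) • (θ : E) ∈ Ω
      · rw [hF, indicator_of_mem hr, indicator_of_mem (by exact hr), enorm_smul,
          ← ofReal_norm (θ : E), hθ, Real.enorm_of_nonneg (le_of_lt r.2)]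
        simp
      · rw [hF, indicator_of_notMem hr, indicator_of_notMem (by exact hr)]
    rw [heq]
    rcases eq_empty_or_nonempty {r : Ioi (0 : ℝ) | (r : ℝ) • (θ : E) ∈ Ω} with h0 | ⟨r₀, hr₀⟩
    · simp [h0]
    rcases eq_or_ne (radialSup Ω (θ : E)) ⊤ with htop | htop
    · simp [htop]
    obtain ⟨P, hP0, hP⟩ : ∃ P : ℝ, 0 < P ∧ radialSup Ω (θ : E) = ENNReal.ofReal P := by
      refine ⟨_, ENNReal.toReal_pos (ne_of_gt ?_) htop, (ENNReal.ofReal_toReal htop).symm⟩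
      exact (ENNReal.ofReal_pos.2 r₀.2).trans_le (ofReal_le_radialSup r₀.2 hr₀)
    calc ENNReal.ofReal (d + 1) *
          Measure.volumeIoiPow d {r : Ioi (0 : ℝ) | (r : ℝ) • (θ : E) ∈ Ω}
        ≤ ENNReal.ofReal (d + 1) * Measure.volumeIoiPow d (Iio ⟨P, hP0⟩) := by
          gcongr
          intro r hr
          have := ofReal_lt_radialSup hΩ r.2 hr
          rw [hP, ENNReal.ofReal_lt_ofReal_iff hP0] at this
          exact this
      _ = radialSup Ω θ ^ (d + 1) := by
          rw [Measure.volumeIoiPow_apply_Iio, ← ENNReal.ofReal_mul (by positivity), hP,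
            ← ENNReal.ofReal_pow hP0.le]
          congr 1
          field_simp
  have hpolar : ∫⁻ x in Ω, ‖x‖ₑ ∂μ = ∫⁻ θ : sphere (0 : E) 1, ∫⁻ r : Ioi (0 : ℝ),
      F ((r : ℝ) • (θ : E)) ∂(Measure.volumeIoiPow (d - 1)) ∂μ.toSphere := by
    calc ∫⁻ x in Ω, ‖x‖ₑ ∂μ = ∫⁻ x in ({0}ᶜ : Set E), F x ∂μ := by
          rw [restrict_compl_singleton, lintegral_indicator hΩ.measurableSet]
      _ = ∫⁻ x : ({0}ᶜ : Set E), F x ∂(μ.comap (↑)) :=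
          (lintegral_subtype_comap (measurableSet_singleton _).compl F).symm
      _ = ∫⁻ p, F ((homeomorphUnitSphereProd E).symm p)
            ∂(μ.toSphere.prod (Measure.volumeIoiPow (d - 1))) :=
          (hmp.lintegral_comp (hFm.comp measurable_subtype_coe)).symm
      _ = _ := by
          rw [lintegral_prod _ (by fun_prop)]
          rfl
  rw [hpolar, ← lintegral_const_mul' _ _ ENNReal.ofReal_ne_top]
  exact lintegral_mono hinner

end

section

variable {E : Type*} [NormedAddCommGroup E] [InnerProductSpace ℝ E]

theorem exists_linearIsometryEquiv_apply_eq {x y : E} (h : ‖x‖ = ‖y‖) :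
    ∃ φ : E ≃ₗᵢ[ℝ] E, φ x = y :=
  ⟨_, Submodule.reflection_sub h⟩

theorem LinearIsometryEquiv.image_ball_inter_sphere (φ : E ≃ₗᵢ[ℝ] E) (x : E) (r s : ℝ) :
    φ '' (ball x r ∩ sphere 0 s) = ball (φ x) r ∩ sphere 0 s := by
  rw [image_inter φ.injective, φ.image_ball, φ.image_sphere, map_zero]

variable [MeasurableSpace E] [BorelSpace E]

theorem setLIntegral_radialSup_pow_le (m : ℕ) {Ω : Set E} (hΩ : IsOpen Ω)
    {l : ℝ≥0} (hl : 1 < l) (k : ℤ) :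
    ∫⁻ θ in {θ : sphere (0 : E) 1 | radialSup Ω θ ∈ Ico ((l : ℝ≥0∞) ^ k) ((l : ℝ≥0∞) ^ (k + 1))},
        radialSup Ω θ ^ (m + 2) ∂(Measure.hausdorffMeasure (m : ℝ)) ≤
      (l : ℝ≥0∞) ^ (m + 2) *
        ∫⁻ x in frontier Ω ∩ {x | ‖x‖ₑ ∈ Ico ((l : ℝ≥0∞) ^ k) ((l : ℝ≥0∞) ^ (k + 1))},
          ‖x‖ₑ ^ 2 ∂(Measure.hausdorffMeasure (m : ℝ)) := by
  have hl0 : l ≠ 0 := (zero_lt_one.trans hl).ne'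
  have hl0' : (l : ℝ≥0∞) ≠ 0 := by exact_mod_cast hl0
  set D : Set (sphere (0 : E) 1) :=
    {θ | radialSup Ω θ ∈ Ico ((l : ℝ≥0∞) ^ k) ((l : ℝ≥0∞) ^ (k + 1))} with hD
  set A : Set E :=
    frontier Ω ∩ {x | ‖x‖ₑ ∈ Ico ((l : ℝ≥0∞) ^ k) ((l : ℝ≥0∞) ^ (k + 1))} with hA
  have hDm : MeasurableSet D :=
    ((measurable_radialSup hΩ).comp measurable_subtype_coe) measurableSet_Ico
  have hAm : MeasurableSet A :=
    isClosed_frontier.measurableSet.inter (measurable_enorm measurableSet_Ico)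
  set a : ℝ≥0 := l ^ k with ha
  have ha0 : 0 < a := zpow_pos (zero_lt_one.trans hl) k
  have hak : (l : ℝ≥0∞) ^ k = a := (ENNReal.coe_zpow hl0 k).symm
  have hak' : (l : ℝ≥0∞) ^ (k + 1) = a * l := by
    rw [ENNReal.zpow_add hl0' ENNReal.coe_ne_top, hak, zpow_one]
  have hsub : (Subtype.val '' D : Set E) ⊆ (fun x : E => ‖x‖⁻¹ • x) '' A := by
    rintro _ ⟨θ, hθD, rfl⟩
    have hθ : ‖(θ : E)‖ = 1 := norm_eq_of_mem_sphere θ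
    have htop : radialSup Ω (θ : E) ≠ ⊤ :=
      (hθD.2.trans_le (by rw [hak', ← ENNReal.coe_mul]; exact le_top)).ne
    have hpos : radialSup Ω (θ : E) ≠ 0 := by
      refine (lt_of_lt_of_le ?_ hθD.1).ne'
      rw [hak]
      exact_mod_cast ha0
    have hP : 0 < (radialSup Ω (θ : E)).toReal := ENNReal.toReal_pos hpos htop
    have hnorm : ‖(radialSup Ω (θ : E)).toReal • (θ : E)‖ = (radialSup Ω (θ : E)).toReal := by
      rw [norm_smul, hθ, mul_one, Real.norm_of_nonneg hP.le]
    refine ⟨(radialSup Ω (θ : E)).toReal • (θ : E), ⟨?_, ?_⟩, ?_⟩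
    · exact smul_mem_frontier_of_radialSup_eq hΩ hθ hP (ENNReal.ofReal_toReal htop).symm
    · rw [mem_ofPred_eq, ← ofReal_norm, hnorm, ENNReal.ofReal_toReal htop]
      exact hθD
    · simp only [hnorm, smul_smul, inv_mul_cancel₀ hP.ne', one_smul]
  have hmeas : Measure.hausdorffMeasure (m : ℝ) D ≤
      (a : ℝ≥0∞)⁻¹ ^ m * Measure.hausdorffMeasure (m : ℝ) A := by
    rw [← isometry_subtype_coe.hausdorffMeasure_image (Or.inl (Nat.cast_nonneg m)) D]
    refine (measure_mono hsub).trans ?_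
    have hlip := ((lipschitzOnWith_normalize (E := E) ha0).mono
      (s := A) fun x hx => ?_).hausdorffMeasure_image_le (Nat.cast_nonneg m)
    · rwa [ENNReal.rpow_natCast, ENNReal.coe_inv ha0.ne'] at hlip
    · have := hx.2.1
      rw [hak] at this
      exact_mod_cast (ENNReal.coe_le_coe.1 this : a ≤ ‖x‖₊)
  calc ∫⁻ θ in D, radialSup Ω θ ^ (m + 2) ∂(Measure.hausdorffMeasure (m : ℝ))
      ≤ ∫⁻ _ in D, ((a : ℝ≥0∞) * l) ^ (m + 2) ∂(Measure.hausdorffMeasure (m : ℝ)) := by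
        refine setLIntegral_mono measurable_const fun θ hθ => ?_
        rw [← hak']
        exact pow_le_pow_left' hθ.2.le _
    _ = ((a : ℝ≥0∞) * l) ^ (m + 2) * Measure.hausdorffMeasure (m : ℝ) D := setLIntegral_const _ _
    _ ≤ ((a : ℝ≥0∞) * l) ^ (m + 2) * ((a : ℝ≥0∞)⁻¹ ^ m * Measure.hausdorffMeasure (m : ℝ) A) := by
        gcongr
    _ = (l : ℝ≥0∞) ^ (m + 2) * ((a : ℝ≥0∞) ^ 2 * Measure.hausdorffMeasure (m : ℝ) A) := by
        have h1 : (a : ℝ≥0∞) ^ m * (a : ℝ≥0∞)⁻¹ ^ m = 1 := by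
          rw [← mul_pow, ENNReal.mul_inv_cancel (by exact_mod_cast ha0.ne') ENNReal.coe_ne_top,
            one_pow]
        calc _ = ((a : ℝ≥0∞) ^ m * (a : ℝ≥0∞)⁻¹ ^ m) *
              ((l : ℝ≥0∞) ^ (m + 2) * ((a : ℝ≥0∞) ^ 2 * Measure.hausdorffMeasure (m : ℝ) A)) := by
              ring
          _ = _ := by rw [h1, one_mul]
    _ ≤ (l : ℝ≥0∞) ^ (m + 2) * ∫⁻ x in A, ‖x‖ₑ ^ 2 ∂(Measure.hausdorffMeasure (m : ℝ)) := by
        gcongr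
        rw [← setLIntegral_const]
        refine setLIntegral_mono (by fun_prop) fun x hx => ?_
        have := hx.2.1
        rw [hak] at this
        gcongr

theorem lintegral_radialSup_pow_le (m : ℕ) {Ω : Set E} (hΩ : IsOpen Ω)
    (hb : Bornology.IsBounded Ω) :
    ∫⁻ θ : sphere (0 : E) 1, radialSup Ω θ ^ (m + 2) ∂(Measure.hausdorffMeasure (m : ℝ)) ≤
      ∫⁻ x in frontier Ω, ‖x‖ₑ ^ 2 ∂(Measure.hausdorffMeasure (m : ℝ)) := by
  set I := ∫⁻ x in frontier Ω, ‖x‖ₑ ^ 2 ∂(Measure.hausdorffMeasure (m : ℝ)) with hI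
  have key : ∀ l : ℝ≥0, 1 < l → ∫⁻ θ : sphere (0 : E) 1, radialSup Ω θ ^ (m + 2)
      ∂(Measure.hausdorffMeasure (m : ℝ)) ≤ (l : ℝ≥0∞) ^ (m + 2) * I := by
    intro l hl
    have hl' : (1 : ℝ≥0∞) < l := by exact_mod_cast hl
    set D : ℤ → Set (sphere (0 : E) 1) := fun k =>
      {θ | radialSup Ω θ ∈ Ico ((l : ℝ≥0∞) ^ k) ((l : ℝ≥0∞) ^ (k + 1))} with hD
    set A : ℤ → Set E := fun k =>
      frontier Ω ∩ {x | ‖x‖ₑ ∈ Ico ((l : ℝ≥0∞) ^ k) ((l : ℝ≥0∞) ^ (k + 1))} with hA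
    have hAm : ∀ k, MeasurableSet (A k) := fun k =>
      isClosed_frontier.measurableSet.inter (measurable_enorm measurableSet_Ico)
    have hAdisj : Pairwise (Function.onFun Disjoint A) := by
      intro i j hij
      have := (ENNReal.monotone_zpow hl'.le).pairwise_disjoint_on_Ico_succ hij
      exact (Disjoint.preimage (fun x : E => ‖x‖ₑ) this).mono inter_subset_right inter_subset_right
    have hcover : ∫⁻ θ : sphere (0 : E) 1, radialSup Ω θ ^ (m + 2)
        ∂(Measure.hausdorffMeasure (m : ℝ)) = ∫⁻ θ in ⋃ k, D k, radialSup Ω θ ^ (m + 2)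
        ∂(Measure.hausdorffMeasure (m : ℝ)) := by
      have hDm : ∀ k, MeasurableSet (D k) := fun k =>
        ((measurable_radialSup hΩ).comp measurable_subtype_coe) measurableSet_Ico
      rw [← lintegral_indicator (MeasurableSet.iUnion hDm)]
      refine lintegral_congr fun θ => ?_
      by_cases hθ : θ ∈ ⋃ k, D k
      · rw [indicator_of_mem hθ]
      · rw [indicator_of_notMem hθ, pow_eq_zero_iff (by omega)]
        by_contra h0
        refine hθ (mem_iUnion.2 ?_)
        exact ENNReal.exists_mem_Ico_zpow h0
          (radialSup_lt_top hb (norm_eq_of_mem_sphere θ)).ne hl' ENNReal.coe_ne_top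
    calc _ = _ := hcover
      _ ≤ ∑' k, ∫⁻ θ in D k, radialSup Ω θ ^ (m + 2) ∂(Measure.hausdorffMeasure (m : ℝ)) :=
          lintegral_iUnion_le _ _
      _ ≤ ∑' k, (l : ℝ≥0∞) ^ (m + 2) *
            ∫⁻ x in A k, ‖x‖ₑ ^ 2 ∂(Measure.hausdorffMeasure (m : ℝ)) :=
          ENNReal.tsum_le_tsum fun k => setLIntegral_radialSup_pow_le m hΩ hl k
      _ = (l : ℝ≥0∞) ^ (m + 2) *
            ∫⁻ x in ⋃ k, A k, ‖x‖ₑ ^ 2 ∂(Measure.hausdorffMeasure (m : ℝ)) := by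
          rw [ENNReal.tsum_mul_left, lintegral_iUnion hAm hAdisj]
      _ ≤ (l : ℝ≥0∞) ^ (m + 2) * I := by
          gcongr
          exact lintegral_mono_set (iUnion_subset fun k => inter_subset_left)
  rcases eq_or_ne I ⊤ with htop | htop
  · rw [htop]; exact le_top
  have hcont : Filter.Tendsto (fun l : ℝ≥0 => (l : ℝ≥0∞) ^ (m + 2) * I) (nhdsWithin 1 (Ioi 1))
      (nhds I) := by
    have h1 : Filter.Tendsto (fun l : ℝ≥0 => (l : ℝ≥0∞) ^ (m + 2)) (nhds 1) (nhds 1) := by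
      have : Continuous fun l : ℝ≥0 => (l : ℝ≥0∞) ^ (m + 2) :=
        (ENNReal.continuous_pow _).comp ENNReal.continuous_coe
      simpa using this.tendsto 1
    have h2 := ENNReal.Tendsto.mul_const (b := I) h1 (Or.inr htop)
    rw [one_mul] at h2
    exact h2.mono_left nhdsWithin_le_nhds
  refine ge_of_tendsto hcont ?_
  filter_upwards [self_mem_nhdsWithin] with l hl using key l hl

theorem hausdorffMeasure_sphere_ball_eq {d : ℝ} (hd : 0 ≤ d) (x y : sphere (0 : E) 1) (r : ℝ) :
    Measure.hausdorffMeasure d (ball x r) = Measure.hausdorffMeasure d (ball y r) := by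
  obtain ⟨φ, hφ⟩ := exists_linearIsometryEquiv_apply_eq
    ((norm_eq_of_mem_sphere x).trans (norm_eq_of_mem_sphere y).symm)
  rw [← isometry_subtype_coe.hausdorffMeasure_image (Or.inl hd) (ball x r),
    ← isometry_subtype_coe.hausdorffMeasure_image (Or.inl hd) (ball y r), Subtype.image_ball,
    Subtype.image_ball, ← hφ]
  exact ((φ.isometry.hausdorffMeasure_image (Or.inl hd) _).symm.trans
    (congrArg _ (φ.image_ball_inter_sphere x r 1)))

open scoped Pointwise in
theorem toSphere_ball_eq [FiniteDimensional ℝ E] (x y : sphere (0 : E) 1) (r : ℝ) :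
    (volume : Measure E).toSphere (ball x r) = (volume : Measure E).toSphere (ball y r) := by
  obtain ⟨φ, hφ⟩ := exists_linearIsometryEquiv_apply_eq
    ((norm_eq_of_mem_sphere x).trans (norm_eq_of_mem_sphere y).symm)
  rw [Measure.toSphere_apply' _ measurableSet_ball, Measure.toSphere_apply' _ measurableSet_ball,
    Subtype.image_ball, Subtype.image_ball, ← hφ]
  congr 1
  have himage : φ '' (Ioo (0 : ℝ) 1 • (ball (x : E) r ∩ sphere 0 1)) =
      Ioo (0 : ℝ) 1 • (ball (φ x) r ∩ sphere 0 1) := by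
    rw [← φ.image_ball_inter_sphere]
    exact image_image2_distrib_right (fun c v => φ.map_smul c v)
  have := φ.measurePreserving.measure_preimage_equiv
    (f := φ.toHomeomorph.toMeasurableEquiv) (φ '' (Ioo (0 : ℝ) 1 • (ball (x : E) r ∩ sphere 0 1)))
  refine Eq.trans ?_ (this.trans (congrArg _ himage))
  congr 1
  exact (preimage_image_eq _ φ.injective).symm

theorem hausdorffMeasure_sphere_smul_toSphere_le [FiniteDimensional ℝ E] {d : ℝ} (hd : 0 ≤ d)
    (hfin : Measure.hausdorffMeasure d (sphere (0 : E) 1) ≠ ⊤) :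
    Measure.hausdorffMeasure d (sphere (0 : E) 1) • (volume : Measure E).toSphere ≤
      (volume : Measure E).toSphere univ •
        (Measure.hausdorffMeasure d : Measure (sphere (0 : E) 1)) := by
  have huniv : (Measure.hausdorffMeasure d : Measure (sphere (0 : E) 1)) univ =
      Measure.hausdorffMeasure d (sphere (0 : E) 1) := by
    rw [← isometry_subtype_coe.hausdorffMeasure_image (Or.inl hd) univ, image_univ,
      Subtype.range_coe]
  have : IsFiniteMeasure (Measure.hausdorffMeasure d : Measure (sphere (0 : E) 1)) :=
    ⟨by rw [huniv]; exact hfin.lt_top⟩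
  rw [← huniv]
  exact smul_le_smul_of_measure_ball_eq (hausdorffMeasure_sphere_ball_eq hd) toSphere_ball_eq

end

section

/-- The bathtub principle: among sets of given measure, a sublevel set of `f` minimizes the
integral of `f`. -/
theorem setIntegral_le_setIntegral_of_measureReal_eq {α : Type*} [MeasurableSpace α]
    {μ : Measure α} {f : α → ℝ} {A A' : Set α} {s : ℝ} (hA : MeasurableSet A)
    (hA' : MeasurableSet A') (hfin : μ A ≠ ⊤) (hfin' : μ A' ≠ ⊤) (heq : μ.real A' = μ.real A)
    (hf : IntegrableOn f A μ) (hf' : IntegrableOn f A' μ) (hs : ∀ x ∈ A \ A', s ≤ f x)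
    (hs' : ∀ x ∈ A' \ A, f x ≤ s) :
    ∫ x in A', f x ∂μ ≤ ∫ x in A, f x ∂μ := by
  have h1 : ∫ _ in A \ A', s ∂μ ≤ ∫ x in A \ A', f x ∂μ :=
    setIntegral_mono_on (integrableOn_const (measure_ne_top_of_subset sdiff_subset hfin))
      (hf.mono_set sdiff_subset) (hA.diff hA') hs
  have h2 : ∫ x in A' \ A, f x ∂μ ≤ ∫ _ in A' \ A, s ∂μ :=
    setIntegral_mono_on (hf'.mono_set sdiff_subset)
      (integrableOn_const (measure_ne_top_of_subset sdiff_subset hfin')) (hA'.diff hA) hs'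
  have h3 := integral_inter_add_sdiff hA' hf
  have h4 := integral_inter_add_sdiff hA hf'
  have h5 := measureReal_inter_add_sdiff (μ := μ) (s := A) hA' hfin
  have h6 := measureReal_inter_add_sdiff (μ := μ) (s := A') hA hfin'
  have h7 : μ.real (A \ A') = μ.real (A' \ A) := by
    rw [inter_comm] at h6
    linarith
  rw [setIntegral_const, smul_eq_mul] at h1 h2
  rw [inter_comm] at h4
  rw [h7] at h1
  linarith

open Module

variable {E : Type*} [NormedAddCommGroup E] [NormedSpace ℝ E] [MeasurableSpace E] [BorelSpace E]
  [FiniteDimensional ℝ E] (μ : Measure E) [μ.IsAddHaarMeasure]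

theorem integrableOn_norm_of_isBounded {s : Set E} (hs : Bornology.IsBounded s) :
    IntegrableOn (fun x : E => ‖x‖) s μ := by
  obtain ⟨r, hr⟩ := hs.subset_closedBall 0
  exact (continuous_norm.continuousOn.integrableOn_compact
    (isCompact_closedBall (0 : E) r)).mono_set hr

variable [Nontrivial E]

theorem finrank_add_one_mul_setIntegral_ball_norm {r : ℝ} (hr : 0 ≤ r) :
    (finrank ℝ E + 1) * ∫ x in ball (0 : E) r, ‖x‖ ∂μ =
      finrank ℝ E * μ.real (ball 0 1) * r ^ (finrank ℝ E + 1) := by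
  have hd : finrank ℝ E ≠ 0 := finrank_pos.ne'
  have h1 : ∫ x in ball (0 : E) r, ‖x‖ ∂μ = ∫ x, (Iio r).indicator (fun y : ℝ => y) ‖x‖ ∂μ := by
    rw [← integral_indicator measurableSet_ball]
    congr 1 with x
    simp [indicator]
  have h2 : ∫ y in Ioi (0 : ℝ), y ^ (finrank ℝ E - 1) • (Iio r).indicator (fun y : ℝ => y) y =
      r ^ (finrank ℝ E + 1) / (finrank ℝ E + 1) := by
    have : (fun y : ℝ => y ^ (finrank ℝ E - 1) • (Iio r).indicator (fun y : ℝ => y) y) =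
        (Iio r).indicator fun y : ℝ => y ^ finrank ℝ E := by
      ext y
      by_cases hy : y < r <;> simp [hy, pow_sub_one_mul hd]
    rw [this, setIntegral_indicator measurableSet_Iio, Ioi_inter_Iio,
      ← integral_Ioc_eq_integral_Ioo, ← intervalIntegral.integral_of_le hr, integral_pow]
    simp
  rw [h1, integral_fun_norm_addHaar, h2, nsmul_eq_mul, smul_eq_mul]
  field_simp

theorem le_finrank_add_one_mul_setIntegral_norm {Ω : Set E} (hΩ : MeasurableSet Ω)
    (hb : Bornology.IsBounded Ω) {R : ℝ} (hR : 0 < R) (hvol : μ (ball 0 R) = μ Ω) :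
    finrank ℝ E * μ.real (ball (0 : E) 1) * R ^ (finrank ℝ E + 1) *
        (1 + ((finrank ℝ E + 1) * ((2 : ℝ) ^ ((1 : ℝ) / finrank ℝ E) - 1) / (4 * finrank ℝ E)) *
          (μ.real (symmDiff Ω (ball 0 R)) / μ.real (ball (0 : E) R)) ^ 2) ≤
      (finrank ℝ E + 1) * ∫ x in Ω, ‖x‖ ∂μ := by
  set d := finrank ℝ E with hd
  have hd0 : (0 : ℝ) < d := by exact_mod_cast finrank_pos (R := ℝ) (M := E)
  set q : ℝ := 1 / d with hq
  have hq0 : 0 < q := by positivity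
  have hq1 : q ≤ 1 := by
    rw [hq, div_le_one hd0]
    exact_mod_cast finrank_pos (R := ℝ) (M := E)
  set B : Set E := ball 0 R with hB
  have hBm : MeasurableSet B := measurableSet_ball
  have hBfin : μ B ≠ ⊤ := measure_ball_lt_top.ne
  have hΩfin : μ Ω ≠ ⊤ := hvol ▸ hBfin
  have hBpos : 0 < μ.real B := ENNReal.toReal_pos (measure_ball_pos μ 0 hR).ne' hBfin
  have hvol' : μ.real Ω = μ.real B := by rw [measureReal_def, measureReal_def, hvol]
  have hball : ∀ r : ℝ, 0 ≤ r → μ.real (ball (0 : E) r) = r ^ d * μ.real (ball (0 : E) 1) := by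
    intro r hr
    rw [measureReal_def, Measure.addHaar_ball μ 0 hr, ENNReal.toReal_mul,
      ENNReal.toReal_ofReal (by positivity), measureReal_def]
  have hΩB := measureReal_inter_add_sdiff (μ := μ) (s := Ω) hBm hΩfin
  have hBΩ := measureReal_inter_add_sdiff (μ := μ) (s := B) hΩ hBfin
  rw [inter_comm] at hBΩ
  set t : ℝ := μ.real (Ω \ B) / μ.real B with ht
  have htB : μ.real (Ω \ B) = t * μ.real B := (div_mul_cancel₀ _ hBpos.ne').symm
  have ht0 : 0 ≤ t := by positivity
  have ht1 : t ≤ 1 := by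
    rw [ht, div_le_one hBpos, ← hvol']
    exact measureReal_mono sdiff_subset hΩfin
  have hsymm : μ.real (symmDiff Ω B) / μ.real B = 2 * t := by
    rw [Set.symmDiff_def, measureReal_union disjoint_sdiff_sdiff (hBm.diff hΩ)
      (measure_ne_top_of_subset sdiff_subset hΩfin) (measure_ne_top_of_subset sdiff_subset hBfin),
      div_eq_iff hBpos.ne']
    linarith
  have hpow : ∀ u : ℝ, 0 ≤ u → (R * u ^ q) ^ d = R ^ d * u := by
    intro u hu
    rw [mul_pow, ← Real.rpow_natCast (u ^ q), ← Real.rpow_mul hu, hq, one_div,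
      inv_mul_cancel₀ hd0.ne', Real.rpow_one]
  have hpow' : ∀ u : ℝ, 0 ≤ u → (R * u ^ q) ^ (d + 1) = R ^ (d + 1) * u ^ (1 + q) := by
    intro u hu
    rw [pow_succ, hpow u hu, Real.rpow_add_of_nonneg hu zero_le_one hq0.le, Real.rpow_one]
    ring
  have hR1 : 0 ≤ R * (1 + t) ^ q := by positivity
  have hR2 : 0 ≤ R * (1 - t) ^ q := mul_nonneg hR.le (Real.rpow_nonneg (by linarith) _)
  have hRR1 : R ≤ R * (1 + t) ^ q :=
    le_mul_of_one_le_right hR.le (Real.one_le_rpow (by linarith) hq0.le)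
  have hnorm : ∀ {s : Set E}, Bornology.IsBounded s → IntegrableOn (fun x : E => ‖x‖) s μ :=
    integrableOn_norm_of_isBounded μ
  have hBsub : B ⊆ ball (0 : E) (R * (1 + t) ^ q) := ball_subset_ball hRR1
  have h1 : ∫ x in ball (0 : E) (R * (1 + t) ^ q) \ B, ‖x‖ ∂μ ≤ ∫ x in Ω \ B, ‖x‖ ∂μ := by
    refine setIntegral_le_setIntegral_of_measureReal_eq (s := R * (1 + t) ^ q) (hΩ.diff hBm)
      (measurableSet_ball.diff hBm) (measure_ne_top_of_subset sdiff_subset hΩfin)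
      (measure_ne_top_of_subset sdiff_subset measure_ball_lt_top.ne) ?_
      (hnorm (hb.subset sdiff_subset)) (hnorm (isBounded_ball.subset sdiff_subset)) ?_ ?_
    · rw [measureReal_sdiff hBsub hBm measure_ball_lt_top.ne, hball _ hR1, hpow _ (by linarith), htB, hB,
        hball R hR.le]
      ring
    · rintro x ⟨hx, hx'⟩
      by_contra! h
      exact hx' ⟨mem_ball_zero_iff.2 h, hx.2⟩
    · rintro x ⟨hx, -⟩
      exact (mem_ball_zero_iff.1 hx.1).le
  have h2 : ∫ x in ball (0 : E) (R * (1 - t) ^ q), ‖x‖ ∂μ ≤ ∫ x in Ω ∩ B, ‖x‖ ∂μ := by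
    refine setIntegral_le_setIntegral_of_measureReal_eq (s := R * (1 - t) ^ q) (hΩ.inter hBm)
      measurableSet_ball (measure_ne_top_of_subset inter_subset_left hΩfin)
      measure_ball_lt_top.ne ?_ (hnorm (hb.subset inter_subset_left)) (hnorm isBounded_ball) ?_ ?_
    · have : μ.real (Ω ∩ B) = (1 - t) * μ.real B := by linarith
      rw [hball _ hR2, hpow _ (by linarith), this, hB, hball R hR.le]
      ring
    · rintro x ⟨-, hx⟩
      exact not_lt.1 fun h => hx (mem_ball_zero_iff.2 h)
    · rintro x ⟨hx, -⟩
      exact (mem_ball_zero_iff.1 hx).le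
  have h3 := integral_inter_add_sdiff hBm (hnorm hb)
  have h4 := setIntegral_sdiff hBm (hnorm (s := ball (0 : E) (R * (1 + t) ^ q)) isBounded_ball) hBsub
  have i0 := finrank_add_one_mul_setIntegral_ball_norm μ hR.le
  have i1 := finrank_add_one_mul_setIntegral_ball_norm μ hR1
  have i2 := finrank_add_one_mul_setIntegral_ball_norm μ hR2
  rw [← hd, hpow' _ (by linarith)] at i1 i2
  rw [← hd] at i0
  have hcoef : (d + 1) * ((2 : ℝ) ^ q - 1) / (4 * d) * (2 * t) ^ 2 =
      (1 + q) * ((2 : ℝ) ^ q - 1) * t ^ 2 := by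
    rw [show (1 : ℝ) + q = (d + 1) / d by rw [hq]; field_simp]
    field_simp
    ring
  rw [hsymm, hcoef]
  calc d * μ.real (ball (0 : E) 1) * R ^ (d + 1) * (1 + (1 + q) * ((2 : ℝ) ^ q - 1) * t ^ 2)
      ≤ d * μ.real (ball (0 : E) 1) * R ^ (d + 1) *
          ((1 + t) ^ (1 + q) + (1 - t) ^ (1 + q) - 1) := by
        have := two_add_mul_sq_le_rpow_add_rpow hq0.le hq1 ht0 ht1
        gcongr
        linarith
    _ = (d + 1) * (∫ x in ball (0 : E) (R * (1 + t) ^ q) \ B, ‖x‖ ∂μ +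
          ∫ x in ball (0 : E) (R * (1 - t) ^ q), ‖x‖ ∂μ) := by
        rw [h4]
        linear_combination i0 - i1 - i2
    _ ≤ (d + 1) * ∫ x in Ω, ‖x‖ ∂μ := by
        gcongr
        linarith

end

section

/-- The part of the boundary of `Ω` in a Lipschitz chart lies on the graph. -/
theorem eq_inner_of_mem_frontier {E : Type*} [NormedAddCommGroup E] [InnerProductSpace ℝ E]
    {Ω : Set E} (hΩ : IsOpen Ω) {p e : E} {r : ℝ} {f : E → ℝ} (hf : Continuous f)
    (h : ∀ y ∈ ball p r, (y ∈ Ω ↔ f (y - ⟪y, e⟫ • e) < ⟪y, e⟫)) {y : E} (hy : y ∈ frontier Ω)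
    (hyr : y ∈ ball p r) : f (y - ⟪y, e⟫ • e) = ⟪y, e⟫ := by
  rw [hΩ.frontier_eq] at hy
  refine le_antisymm ?_ (not_lt.1 fun hlt => hy.2 ((h y hyr).2 hlt))
  by_contra! hlt
  have hopen : IsOpen {z : E | ⟪z, e⟫ < f (z - ⟪z, e⟫ • e)} :=
    isOpen_lt (by fun_prop) (by fun_prop)
  obtain ⟨z, ⟨hz, hzr⟩, hzΩ⟩ := mem_closure_iff.1 hy.1 _ (hopen.inter isOpen_ball) ⟨hlt, hyr⟩
  exact ((h z hzr).1 hzΩ).not_gt hz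

theorem surfMeasure_frontier_lt_top {n : ℕ} (hn : 0 < n) {Ω : Set (EuclideanSpace ℝ (Fin n))}
    (hopen : IsOpen Ω) (hbdd : Bornology.IsBounded Ω) (hlip : HasLipschitzBoundary Ω) :
    surfMeasure n (frontier Ω) < ⊤ := by
  obtain ⟨m, rfl⟩ : ∃ m, n = m + 1 := ⟨n - 1, by omega⟩
  have hm : ((m + 1 : ℕ) : ℝ) - 1 = m := by push_cast; ring
  have hcompact : IsCompact (frontier Ω) :=
    isCompact_of_isClosed_isBounded isClosed_frontier
      (hbdd.closure.subset frontier_subset_closure)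
  refine hcompact.measure_lt_top_of_nhdsWithin fun p hp => ?_
  obtain ⟨r, hr, e, he, f, ⟨K, hf⟩, hΩ⟩ := hlip p hp
  refine ⟨frontier Ω ∩ ball p r, inter_mem_nhdsWithin _ (ball_mem_nhds p hr), ?_⟩
  set V := (ℝ ∙ e)ᗮ with hV
  have : Fact (Module.finrank ℝ (EuclideanSpace ℝ (Fin (m + 1))) = m + 1) :=
    ⟨finrank_euclideanSpace_fin⟩
  have hVd : Module.finrank ℝ V = m :=
    Submodule.finrank_orthogonal_span_singleton (by rintro rfl; simp at he)
  have hg : LipschitzWith (1 + K) fun v : V => (v : EuclideanSpace ℝ (Fin (m + 1))) + f v • e := by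
    refine (LipschitzWith.subtype_val (V : Set (EuclideanSpace ℝ (Fin (m + 1))))).add ?_
    refine LipschitzWith.of_dist_le_mul fun v w => ?_
    rw [dist_eq_norm, ← sub_smul, norm_smul, he, mul_one, ← dist_eq_norm]
    exact hf.dist_le_mul v w
  have hsub : frontier Ω ∩ ball p r ⊆
      (fun v : V => (v : EuclideanSpace ℝ (Fin (m + 1))) + f v • e) ''
        closedBall 0 (2 * (‖p‖ + r)) := by
    rintro y ⟨hyΩ, hyr⟩
    have hy := eq_inner_of_mem_frontier hopen hf.continuous hΩ hyΩ hyr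
    have hyV : y - ⟪y, e⟫ • e ∈ V := by
      rw [hV, Submodule.mem_orthogonal_singleton_iff_inner_right, inner_sub_right, inner_smul_right,
        real_inner_self_eq_norm_sq, he, real_inner_comm]
      ring
    refine ⟨⟨_, hyV⟩, ?_, ?_⟩
    · rw [mem_closedBall_zero_iff, Submodule.coe_norm]
      have h1 : ‖⟪y, e⟫ • e‖ ≤ ‖y‖ := by
        rw [norm_smul, he, mul_one]
        simpa [he] using norm_inner_le_norm (𝕜 := ℝ) y e
      have h2 : ‖y‖ ≤ ‖p‖ + r := by
        have := norm_le_norm_add_norm_sub' y p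
        rw [mem_ball, dist_eq_norm] at hyr
        linarith
      linarith [norm_sub_le y (⟪y, e⟫ • e)]
    · simp only [hy, sub_add_cancel]
  have hfin : Measure.hausdorffMeasure (m : ℝ) (closedBall (0 : V) (2 * (‖p‖ + r))) < ⊤ := by
    have := (isCompact_closedBall (0 : V) (2 * (‖p‖ + r))).measure_lt_top
      (μ := Measure.hausdorffMeasure (Module.finrank ℝ V : ℝ))
    rwa [hVd] at this
  rw [surfMeasure, hm]
  refine (measure_mono hsub).trans_lt
    ((hg.hausdorffMeasure_image_le (Nat.cast_nonneg m) _).trans_lt ?_)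
  exact ENNReal.mul_lt_top (ENNReal.rpow_lt_top_of_nonneg (Nat.cast_nonneg m) ENNReal.coe_ne_top) hfin

end

theorem surfMeasure_eq {n : ℕ} (hn : 0 < n) :
    surfMeasure n = Measure.hausdorffMeasure ((n - 1 : ℕ) : ℝ) := by
  rw [surfMeasure, Nat.cast_sub hn, Nat.cast_one]

open scoped Pointwise in
theorem surfMeasure_sphere {n : ℕ} (hn : 0 < n) {R : ℝ} (hR : 0 < R) :
    surfMeasure n (sphere 0 R) = ENNReal.ofReal (R ^ (n - 1)) * surfMeasure n (sphere 0 1) := by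
  have hs : sphere (0 : EuclideanSpace ℝ (Fin n)) R = R • sphere 0 1 := by
    rw [smul_sphere' hR.ne', smul_zero, mul_one, Real.norm_of_nonneg hR.le]
  rw [surfMeasure_eq hn, hs, Measure.hausdorffMeasure_smul₀ (Nat.cast_nonneg _) hR.ne',
    NNReal.rpow_natCast, ENNReal.smul_def, smul_eq_mul, ENNReal.ofReal_pow hR.le, ENNReal.coe_pow,
    Real.nnnorm_of_nonneg hR.le, ENNReal.ofReal_eq_coe_nnreal hR.le]

theorem surfMeasure_sphere_mul_setLIntegral_enorm_le {n : ℕ} (hn : 0 < n)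
    {Ω : Set (EuclideanSpace ℝ (Fin n))} (hopen : IsOpen Ω) (hbdd : Bornology.IsBounded Ω)
    (hfin : surfMeasure n (sphere 0 1) ≠ ⊤) :
    surfMeasure n (sphere 0 1) * (ENNReal.ofReal (n + 1) * ∫⁻ x in Ω, ‖x‖ₑ) ≤
      n * volume (ball (0 : EuclideanSpace ℝ (Fin n)) 1) *
        ∫⁻ x in frontier Ω, ‖x‖ₑ ^ 2 ∂(surfMeasure n) := by
  have : Nonempty (Fin n) := ⟨⟨0, hn⟩⟩
  have hd : Module.finrank ℝ (EuclideanSpace ℝ (Fin n)) = n := finrank_euclideanSpace_fin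
  have hvol := finrank_add_one_mul_setLIntegral_enorm_le
    (volume : Measure (EuclideanSpace ℝ (Fin n))) hopen
  have hsurf := lintegral_radialSup_pow_le (n - 1) hopen hbdd
  rw [surfMeasure_eq hn] at hfin ⊢
  have huniq := hausdorffMeasure_sphere_smul_toSphere_le (Nat.cast_nonneg _) hfin
  rw [hd] at hvol
  rw [show n - 1 + 2 = n + 1 by omega] at hsurf
  calc _ ≤ _ := mul_le_mul_right hvol _
    _ = _ := by rw [← smul_eq_mul, ← lintegral_smul_measure]
    _ ≤ _ := lintegral_mono' huniq le_rfl
    _ = _ := by rw [lintegral_smul_measure, smul_eq_mul]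
    _ ≤ _ := mul_le_mul_right hsurf _
    _ = _ := by rw [Measure.toSphere_apply_univ, hd]

/-- **Weighted isoperimetric inequality (Betta–Brock–Mercaldo–Posteraro /
Brasco–De Philippis–Ruffini).**  If `Ω ⊆ ℝⁿ` is a bounded open Lipschitz set
and `B_R` is the ball centred at the origin with `|B_R| = |Ω|`, then
`∫_{∂Ω} |x|² ≥ R² |∂B_R| (1 + ((n+1)(2^{1/n}−1)/(4n)) (|Ω Δ B_R|/|B_R|)²)`. -/
theorem boundary_moment_isoperimetric
    (n : ℕ) (hn : 0 < n) (Ω : Set (EuclideanSpace ℝ (Fin n)))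
    (hopen : IsOpen Ω) (hbdd : Bornology.IsBounded Ω) (hne : Ω.Nonempty)
    (hlip : HasLipschitzBoundary Ω)
    (R : ℝ) (hR : 0 ≤ R)
    (hvol : volume (ball (0 : EuclideanSpace ℝ (Fin n)) R) = volume Ω) :
    R ^ 2 * ((surfMeasure n) (sphere (0 : EuclideanSpace ℝ (Fin n)) R)).toReal *
        (1 + ((n + 1) * ((2:ℝ) ^ ((1:ℝ)/n) - 1) / (4 * n)) *
          ((volume (symmDiff Ω (ball (0 : EuclideanSpace ℝ (Fin n)) R))).toReal /
            (volume (ball (0 : EuclideanSpace ℝ (Fin n)) R)).toReal) ^ 2)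
      ≤ ∫ x in frontier Ω, ‖x‖ ^ 2 ∂(surfMeasure n) := by
  have hE : Nonempty (Fin n) := ⟨⟨0, hn⟩⟩
  have hd : Module.finrank ℝ (EuclideanSpace ℝ (Fin n)) = n := finrank_euclideanSpace_fin
  have hRpos : 0 < R := by
    refine hR.lt_of_ne fun h => (hopen.measure_pos volume hne).ne' ?_
    rw [← hvol, ← h, ball_zero, measure_empty]
  rw [surfMeasure_sphere hn hRpos, ENNReal.toReal_mul, ENNReal.toReal_ofReal (by positivity)]
  rcases eq_or_ne (surfMeasure n (sphere 0 1)) ⊤ with htop | hfin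
  · rw [htop, ENNReal.toReal_top, mul_zero, mul_zero, zero_mul]
    exact integral_nonneg fun x => by positivity
  have hbound := le_finrank_add_one_mul_setIntegral_norm volume hopen.measurableSet hbdd hRpos hvol
  have hchain := surfMeasure_sphere_mul_setLIntegral_enorm_le hn hopen hbdd hfin
  have hmoment : ∫⁻ x in frontier Ω, ‖x‖ₑ ^ 2 ∂(surfMeasure n) ≠ ⊤ := by
    obtain ⟨C, hC⟩ := (hbdd.closure.subset frontier_subset_closure).exists_norm_le
    refine ne_top_of_le_ne_top (ENNReal.mul_ne_top (b := surfMeasure n (frontier Ω))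
      (ENNReal.pow_ne_top (n := 2) (ENNReal.ofReal_ne_top (r := C)))
      (surfMeasure_frontier_lt_top hn hopen hbdd hlip).ne) ?_
    rw [← setLIntegral_const]
    refine setLIntegral_mono measurable_const fun x hx => ?_
    rw [← ofReal_norm]
    gcongr
    exact hC x hx
  have hI : ∫ x in frontier Ω, ‖x‖ ^ 2 ∂(surfMeasure n) =
      (∫⁻ x in frontier Ω, ‖x‖ₑ ^ 2 ∂(surfMeasure n)).toReal := by
    rw [integral_eq_lintegral_of_nonneg_ae (.of_forall fun x => by positivity)
      (by fun_prop)]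
    simp_rw [ENNReal.ofReal_pow (norm_nonneg _), ofReal_norm]
  have hJ : ∫ x in Ω, ‖x‖ = (∫⁻ x in Ω, ‖x‖ₑ).toReal :=
    integral_norm_eq_lintegral_enorm (by fun_prop)
  have hball : 0 < volume.real (ball (0 : EuclideanSpace ℝ (Fin n)) 1) :=
    ENNReal.toReal_pos (measure_ball_pos volume 0 one_pos).ne' measure_ball_lt_top.ne
  have hchain' := ENNReal.toReal_mono (ENNReal.mul_ne_top
    (ENNReal.mul_ne_top (ENNReal.natCast_ne_top n) measure_ball_lt_top.ne) hmoment) hchain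
  rw [ENNReal.toReal_mul, ENNReal.toReal_mul, ENNReal.toReal_mul, ENNReal.toReal_mul,
    ENNReal.toReal_ofReal (by positivity), ENNReal.toReal_natCast, ← hI, ← hJ,
    ← measureReal_def volume] at hchain'
  rw [hd, measureReal_def volume (symmDiff _ _), measureReal_def volume (ball _ R)] at hbound
  have hmul := mul_le_mul_of_nonneg_left hbound
    (ENNReal.toReal_nonneg (a := surfMeasure n (sphere 0 1)))
  have hpow : R ^ 2 * R ^ (n - 1) = R ^ (n + 1) := by
    rw [← pow_add]
    congr 1
    omega
  refine le_of_mul_le_mul_left ?_ (mul_pos (Nat.cast_pos.2 hn) hball)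
  refine le_trans (le_of_eq ?_) (hmul.trans hchain')
  rw [← mul_assoc (R ^ 2), hpow]
  ring
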